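/- Let T = (T, η, μ) be a monad on Set and F : Set ⥤ Set an endofunctor with a T-algebra lifting F*. If h : X → Y is a homomorphism of FT-coalgebras from (X, f) to (Y, g), i.e. g ∘ h = F(T(h)) ∘ f, then T(h) : T X → T Y is an F-coalgebra homomorphism from (T X, f♯) to (T Y, g♯), i.e. g♯ ∘ T(h) = F(T(h)) ∘ f♯. Consequently the assignment (X, f) ↦ (T X, f♯), h ↦ T(h) defines a functor from the category of FT-coalgebras to the category of F-coalgebras. -/

import Mathlib

open CategoryTheory CategoryTheory.Limits

universe u

/-- The carrier of `F*(T.free X)` is `F (T X)`, from the lifting equation. -/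
def carrierEq {T : Monad (Type u)} {F : Type u ⥤ Type u}
    {Fstar : Monad.Algebra T ⥤ Monad.Algebra T}
    (hl : Fstar ⋙ T.forget = T.forget ⋙ F) (X : Type u) :
    (Fstar.obj (T.free.obj X)).A = F.obj (T.obj X) :=
  Functor.congr_obj hl (T.free.obj X)

/-- The `T`-algebra structure map `h_X : T (F (T X)) → F (T X)` coming from the lifting. -/
def structMap {T : Monad (Type u)} {F : Type u ⥤ Type u}
    {Fstar : Monad.Algebra T ⥤ Monad.Algebra T}
    (hl : Fstar ⋙ T.forget = T.forget ⋙ F) (X : Type u) :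
    T.obj (F.obj (T.obj X)) ⟶ F.obj (T.obj X) :=
  eqToHom (congrArg T.obj (carrierEq hl X).symm) ≫ (Fstar.obj (T.free.obj X)).a ≫
    eqToHom (carrierEq hl X)

/-- `f♯ = h_X ∘ T f : T X → F (T X)`. -/
def fSharp {T : Monad (Type u)} {F : Type u ⥤ Type u}
    {Fstar : Monad.Algebra T ⥤ Monad.Algebra T}
    (hl : Fstar ⋙ T.forget = T.forget ⋙ F) {X : Type u}
    (f : X ⟶ F.obj (T.obj X)) : T.obj X ⟶ F.obj (T.obj X) :=
  T.map f ≫ structMap hl X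

/-- The structure maps `h_X` are natural in `X`. -/
theorem structMap_naturality {T : Monad (Type u)} {F : Type u ⥤ Type u}
    {Fstar : Monad.Algebra T ⥤ Monad.Algebra T}
    (hl : Fstar ⋙ T.forget = T.forget ⋙ F) {X Y : Type u} (h : X ⟶ Y) :
    T.map (F.map (T.map h)) ≫ structMap hl Y = structMap hl X ≫ F.map (T.map h) := by
  have key : F.map (T.map h) = eqToHom (carrierEq hl X).symm ≫
      (Fstar.map (T.free.map h)).f ≫ eqToHom (carrierEq hl Y) :=
    Functor.congr_hom hl.symm (T.free.map h)
  rw [key]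
  simp only [structMap, Functor.map_comp, eqToHom_map, Category.assoc, eqToHom_trans_assoc,
    eqToHom_refl, Category.id_comp]
  rw [Monad.Algebra.Hom.h_assoc]

theorem fSharp_naturality {T : Monad (Type u)} {F : Type u ⥤ Type u}
    {Fstar : Monad.Algebra T ⥤ Monad.Algebra T}
    (hl : Fstar ⋙ T.forget = T.forget ⋙ F) {X Y : Type u}
    {f : X ⟶ F.obj (T.obj X)} {g : Y ⟶ F.obj (T.obj Y)} {h : X ⟶ Y}
    (w : h ≫ g = f ≫ F.map (T.map h)) :
    T.map h ≫ fSharp hl g = fSharp hl f ≫ F.map (T.map h) := by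
  simp only [fSharp, Category.assoc]
  rw [← structMap_naturality hl h, ← Functor.map_comp_assoc, w, Functor.map_comp_assoc]

/-- The determinization functor `(X, f) ↦ (T X, f♯)`, `h ↦ T h`. -/
def determinization {T : Monad (Type u)} {F : Type u ⥤ Type u}
    {Fstar : Monad.Algebra T ⥤ Monad.Algebra T}
    (hl : Fstar ⋙ T.forget = T.forget ⋙ F) :
    Endofunctor.Coalgebra (T.toFunctor ⋙ F) ⥤ Endofunctor.Coalgebra F where
  obj C := ⟨T.obj C.V, fSharp hl C.str⟩
  map k := ⟨T.map k.f, (fSharp_naturality hl k.h.symm).symm⟩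
  map_id C := Endofunctor.Coalgebra.Hom.ext (T.map_id C.V)
  map_comp k l := Endofunctor.Coalgebra.Hom.ext (T.map_comp k.f l.f)

/-- if `h` is a homomorphism of `FT`-coalgebras, then `T h` is an
`F`-coalgebra homomorphism between the determinizations; consequently the assignment
`(X, f) ↦ (T X, f♯)`, `h ↦ T h` is a functor from `FT`-coalgebras to `F`-coalgebras. -/
theorem determinization_functor
    (T : Monad (Type u)) (F : Type u ⥤ Type u)
    (Fstar : Monad.Algebra T ⥤ Monad.Algebra T)
    (hl : Fstar ⋙ T.forget = T.forget ⋙ F) :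
    (∀ (X Y : Type u) (f : X ⟶ F.obj (T.obj X)) (g : Y ⟶ F.obj (T.obj Y)) (h : X ⟶ Y),
        h ≫ g = f ≫ F.map (T.map h) →
        T.map h ≫ fSharp hl g = fSharp hl f ≫ F.map (T.map h)) ∧
    ∃ G : Endofunctor.Coalgebra (T.toFunctor ⋙ F) ⥤ Endofunctor.Coalgebra F,
      (∀ C : Endofunctor.Coalgebra (T.toFunctor ⋙ F),
          G.obj C = ⟨T.obj C.V, fSharp hl C.str⟩) ∧
      (∀ (C D : Endofunctor.Coalgebra (T.toFunctor ⋙ F)) (k : C ⟶ D),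
          HEq (G.map k).f (T.map k.f)) := by
  exact ⟨fun _ _ _ _ _ w => fSharp_naturality hl w,
    determinization hl, fun _ => rfl, fun _ _ _ => HEq.rfl⟩
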